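/- Let d ≥ 2 with d ≠ 3. Let U be a d×d unitary matrix, F a 2×2 integer matrix with det F ≡ 1 (mod d̄) and trace F ≡ −1 (mod d), and χ ∈ ℤ², and suppose that U D_p U† = ω^{⟨χ, Fp⟩} D_{Fp} for all p ∈ ℤ². Then U³ is a scalar multiple of the identity, while neither U nor U² is a scalar multiple of the identity; in other words, the Clifford operation determined by U has order exactly 3. -/

import Mathlib

noncomputable section
open Matrix Complex

/-- `d̄ = d` for odd `d`, `2d` for even `d`. -/
def dbar (d : ℕ) : ℕ := if d % 2 = 1 then d else 2 * d

/-- `ω = exp(2πi/d)`. -/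
def omega (d : ℕ) : ℂ := Complex.exp (2 * Real.pi * Complex.I / d)

/-- `τ = −exp(πi/d)`. -/
def tau (d : ℕ) : ℂ := -Complex.exp (Real.pi * Complex.I / d)

/-- The diagonal matrix `T e_r = ω^r e_r`. -/
def Tmat (d : ℕ) : Matrix (Fin d) (Fin d) ℂ :=
  Matrix.diagonal fun r => omega d ^ (r : ℕ)

/-- The cyclic shift `S e_r = e_{r+1 mod d}`. -/
def Smat (d : ℕ) : Matrix (Fin d) (Fin d) ℂ :=
  Matrix.of fun r s => if (r : ℕ) = ((s : ℕ) + 1) % d then 1 else 0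

/-- The displacement operators `D_p = τ^{p₁p₂} S^{p₁} T^{p₂}`. -/
def Dmat (d : ℕ) (p : ℤ × ℤ) : Matrix (Fin d) (Fin d) ℂ :=
  tau d ^ (p.1 * p.2) • (Smat d ^ p.1 * Tmat d ^ p.2)

/-- The symplectic form `⟨p,q⟩ = p₂q₁ − p₁q₂`. -/
def symp (p q : ℤ × ℤ) : ℤ := p.2 * q.1 - p.1 * q.2

/-- Action of a 2×2 integer matrix on `ℤ²`. -/
def Fapp (F : Matrix (Fin 2) (Fin 2) ℤ) (p : ℤ × ℤ) : ℤ × ℤ :=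
  (F 0 0 * p.1 + F 0 1 * p.2, F 1 0 * p.1 + F 1 1 * p.2)

/-- The generalized Pauli group `W(d) = {e^{iξ} D_p}`, as a set of matrices. -/
def Wset (d : ℕ) : Set (Matrix (Fin d) (Fin d) ℂ) :=
  {M | ∃ ξ : ℝ, ∃ p : ℤ × ℤ, M = Complex.exp (ξ * Complex.I) • Dmat d p}

theorem omega_isPrimitiveRoot {d : ℕ} (hd : d ≠ 0) : IsPrimitiveRoot (omega d) d :=
  Complex.isPrimitiveRoot_exp d hd

theorem omega_ne_zero (d : ℕ) : omega d ≠ 0 := Complex.exp_ne_zero _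

theorem tau_ne_zero (d : ℕ) : tau d ≠ 0 := neg_ne_zero.2 (Complex.exp_ne_zero _)

theorem tau_pow_dbar {d : ℕ} (hd : d ≠ 0) : tau d ^ dbar d = 1 := by
  have hd' : (d : ℂ) ≠ 0 := Nat.cast_ne_zero.2 hd
  have h : Complex.exp (Real.pi * Complex.I / d) ^ d = -1 := by
    rw [← Complex.exp_nat_mul, mul_div_cancel₀ _ hd', Complex.exp_pi_mul_I]
  unfold tau dbar
  split_ifs with ho
  · rw [(Nat.odd_iff.2 ho).neg_pow, h, neg_neg]
  · rw [(even_two_mul d).neg_pow, mul_comm 2 d, pow_mul, h]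
    norm_num

theorem Smat_pow_apply {d : ℕ} (hd : d ≠ 0) (n : ℕ) (r s : Fin d) :
    (Smat d ^ n) r s = if (r : ℕ) = ((s : ℕ) + n) % d then 1 else 0 := by
  induction n generalizing r s with
  | zero => simp [Matrix.one_apply, Nat.mod_eq_of_lt s.2, Fin.ext_iff]
  | succ n ih =>
    rw [pow_succ, Matrix.mul_apply,
      Finset.sum_eq_single ⟨((s : ℕ) + 1) % d, Nat.mod_lt _ (Nat.pos_of_ne_zero hd)⟩]
    · rw [ih]
      simp [Smat, add_assoc, add_comm 1 n]
    · intro k _ hk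
      have : (k : ℕ) ≠ ((s : ℕ) + 1) % d := fun h => hk (Fin.ext h)
      simp [Smat, this]
    · simp

theorem Smat_pow_self {d : ℕ} (hd : d ≠ 0) : Smat d ^ d = 1 := by
  ext r s
  simp [Smat_pow_apply hd, Matrix.one_apply, Nat.mod_eq_of_lt s.2, Fin.ext_iff]

theorem Tmat_pow_self {d : ℕ} (hd : d ≠ 0) : Tmat d ^ d = 1 := by
  rw [Tmat, Matrix.diagonal_pow, ← Matrix.diagonal_one]
  congr 1
  ext r
  simp only [Pi.pow_apply]
  rw [pow_right_comm, (omega_isPrimitiveRoot hd).pow_eq_one, one_pow]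

theorem Matrix.isUnit_det_of_pow_eq_one {n R : Type*} [Fintype n] [DecidableEq n] [CommRing R]
    {A : Matrix n n R} {m : ℕ} (hm : m ≠ 0) (h : A ^ m = 1) : IsUnit A.det :=
  (Matrix.isUnit_iff_isUnit_det _).1 (IsUnit.of_pow_eq_one h hm)

theorem Matrix.zpow_eq_zpow_of_modEq {n R : Type*} [Fintype n] [DecidableEq n] [CommRing R]
    {A : Matrix n n R} {m : ℕ} (hm : m ≠ 0) (h : A ^ m = 1) {a b : ℤ} (hab : a ≡ b [ZMOD m]) :
    A ^ a = A ^ b := by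
  have hA := Matrix.isUnit_det_of_pow_eq_one hm h
  obtain ⟨k, hk⟩ := hab.dvd
  obtain rfl : b = a + m * k := by lia
  rw [Matrix.zpow_add hA, Matrix.zpow_mul A hA, zpow_natCast, h, Matrix.one_zpow, mul_one]

theorem zpow_eq_zpow_of_modEq {K : Type*} [Field K] {x : K} {m : ℕ} (hx : x ≠ 0)
    (h : x ^ m = 1) {a b : ℤ} (hab : a ≡ b [ZMOD m]) : x ^ a = x ^ b := by
  obtain ⟨k, hk⟩ := hab.dvd
  obtain rfl : b = a + m * k := by lia
  rw [zpow_add₀ hx, _root_.zpow_mul, zpow_natCast, h, _root_.one_zpow, mul_one]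

theorem Dmat_congr {d : ℕ} (hd : d ≠ 0) {p q : ℤ × ℤ} (h₁ : p.1 ≡ q.1 [ZMOD d])
    (h₂ : p.2 ≡ q.2 [ZMOD d]) (h : p.1 * p.2 ≡ q.1 * q.2 [ZMOD dbar d]) :
    Dmat d p = Dmat d q := by
  rw [Dmat, Dmat, zpow_eq_zpow_of_modEq (tau_ne_zero d) (tau_pow_dbar hd) h,
    Matrix.zpow_eq_zpow_of_modEq hd (Smat_pow_self hd) h₁,
    Matrix.zpow_eq_zpow_of_modEq hd (Tmat_pow_self hd) h₂]

theorem Dmat_one_zero (d : ℕ) : Dmat d (1, 0) = Smat d := by simp [Dmat]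

theorem Dmat_zero_one (d : ℕ) : Dmat d (0, 1) = Tmat d := by simp [Dmat]

theorem isUnit_det_Smat {d : ℕ} (hd : d ≠ 0) : IsUnit (Smat d).det :=
  Matrix.isUnit_det_of_pow_eq_one hd (Smat_pow_self hd)

theorem isUnit_det_Tmat {d : ℕ} (hd : d ≠ 0) : IsUnit (Tmat d).det :=
  Matrix.isUnit_det_of_pow_eq_one hd (Tmat_pow_self hd)

theorem isUnit_Dmat {d : ℕ} (hd : d ≠ 0) (p : ℤ × ℤ) : IsUnit (Dmat d p) := by
  have hS := (Matrix.isUnit_iff_isUnit_det _).2 ((isUnit_det_Smat hd).det_zpow p.1)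
  have hT := (Matrix.isUnit_iff_isUnit_det _).2 ((isUnit_det_Tmat hd).det_zpow p.2)
  exact (hS.mul hT).smul (Units.mk0 _ (zpow_ne_zero _ (tau_ne_zero d)))

theorem Tmat_mul_Smat {d : ℕ} (hd : d ≠ 0) : Tmat d * Smat d = omega d • (Smat d * Tmat d) := by
  ext r s
  simp only [Tmat, Smat, Matrix.diagonal_mul, Matrix.mul_diagonal, Matrix.smul_apply,
    Matrix.of_apply, smul_eq_mul]
  split_ifs with h
  · rw [h, ← pow_eq_pow_mod _ (omega_isPrimitiveRoot hd).pow_eq_one]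
    ring
  · simp

theorem Matrix.mul_zpow_of_mul_eq_smul {n K : Type*} [Fintype n] [DecidableEq n] [Field K]
    {A B : Matrix n n K} {z : K} (hz : z ≠ 0) (hB : IsUnit B.det)
    (h : A * B = z • (B * A)) (m : ℤ) : A * B ^ m = z ^ m • (B ^ m * A) := by
  induction m with
  | zero => simp
  | succ m ih =>
    rw [Matrix.zpow_add_one hB, ← mul_assoc, ih, Matrix.smul_mul, mul_assoc, h,
      Matrix.mul_smul, smul_smul, zpow_add_one₀ hz, mul_assoc]
  | pred m ih =>
    have h' : A * B⁻¹ = z⁻¹ • (B⁻¹ * A) := by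
      have h2 : A = z • (B * A * B⁻¹) := by
        rw [← Matrix.smul_mul, ← h, Matrix.mul_nonsing_inv_cancel_right _ _ hB]
      rw [eq_inv_smul_iff₀ hz]
      conv_rhs => rw [h2]
      rw [Matrix.mul_smul, mul_assoc B, Matrix.nonsing_inv_mul_cancel_left _ _ hB]
    rw [Matrix.zpow_sub_one hB, ← mul_assoc, ih, Matrix.smul_mul, mul_assoc, h',
      Matrix.mul_smul, smul_smul, zpow_sub_one₀ hz, mul_assoc]

theorem Tmat_mul_Dmat {d : ℕ} (hd : d ≠ 0) (p : ℤ × ℤ) :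
    Tmat d * Dmat d p = omega d ^ p.1 • (Dmat d p * Tmat d) := by
  have hT : Tmat d * Tmat d ^ p.2 = Tmat d ^ p.2 * Tmat d :=
    (Matrix.Commute.self_zpow _ _).eq
  rw [Dmat, Matrix.mul_smul, ← mul_assoc, Matrix.mul_zpow_of_mul_eq_smul (omega_ne_zero d)
    (isUnit_det_Smat hd) (Tmat_mul_Smat hd), Matrix.smul_mul, mul_assoc, hT, Matrix.smul_mul,
    smul_comm, mul_assoc]

theorem Smat_mul_Dmat {d : ℕ} (hd : d ≠ 0) (p : ℤ × ℤ) :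
    Smat d * Dmat d p = (omega d)⁻¹ ^ p.2 • (Dmat d p * Smat d) := by
  have hS : Smat d * Smat d ^ p.1 = Smat d ^ p.1 * Smat d :=
    (Matrix.Commute.self_zpow _ _).eq
  have h : Smat d * Tmat d = (omega d)⁻¹ • (Tmat d * Smat d) := by
    rw [Tmat_mul_Smat hd, inv_smul_smul₀ (omega_ne_zero d)]
  rw [Dmat, Matrix.mul_smul, ← mul_assoc, hS, mul_assoc, Matrix.mul_zpow_of_mul_eq_smul
    (inv_ne_zero (omega_ne_zero d)) (isUnit_det_Tmat hd) h, Matrix.smul_mul, Matrix.mul_smul,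
    smul_comm, mul_assoc]

theorem omega_zpow_eq_one_iff {d : ℕ} (hd : d ≠ 0) (a : ℤ) : omega d ^ a = 1 ↔ (d : ℤ) ∣ a :=
  (omega_isPrimitiveRoot hd).zpow_eq_one_iff_dvd a

theorem fst_modEq_of_Dmat_eq_smul {d : ℕ} (hd : d ≠ 0) {p q : ℤ × ℤ} {z : ℂ}
    (h : Dmat d p = z • Dmat d q) : p.1 ≡ q.1 [ZMOD d] := by
  have : NeZero d := ⟨hd⟩
  have h1 := Tmat_mul_Dmat hd p
  have h2 : Tmat d * Dmat d p = omega d ^ q.1 • (Dmat d p * Tmat d) := by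
    rw [h, Matrix.mul_smul, Tmat_mul_Dmat hd, Matrix.smul_mul, smul_comm]
  have hne : Dmat d p * Tmat d ≠ 0 := ((isUnit_Dmat hd p).mul
    ((Matrix.isUnit_iff_isUnit_det _).2 (isUnit_det_Tmat hd))).ne_zero
  have h3 : omega d ^ p.1 = omega d ^ q.1 := smul_left_injective ℂ hne (h1.symm.trans h2)
  rw [Int.modEq_comm, Int.modEq_iff_dvd, ← omega_zpow_eq_one_iff hd, zpow_sub₀ (omega_ne_zero d),
    h3, div_self (zpow_ne_zero _ (omega_ne_zero d))]

theorem snd_modEq_of_Dmat_eq_smul {d : ℕ} (hd : d ≠ 0) {p q : ℤ × ℤ} {z : ℂ}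
    (h : Dmat d p = z • Dmat d q) : p.2 ≡ q.2 [ZMOD d] := by
  have : NeZero d := ⟨hd⟩
  have h1 := Smat_mul_Dmat hd p
  have h2 : Smat d * Dmat d p = (omega d)⁻¹ ^ q.2 • (Dmat d p * Smat d) := by
    rw [h, Matrix.mul_smul, Smat_mul_Dmat hd, Matrix.smul_mul, smul_comm]
  have hne : Dmat d p * Smat d ≠ 0 := ((isUnit_Dmat hd p).mul
    ((Matrix.isUnit_iff_isUnit_det _).2 (isUnit_det_Smat hd))).ne_zero
  have h3 : (omega d)⁻¹ ^ p.2 = (omega d)⁻¹ ^ q.2 := smul_left_injective ℂ hne (h1.symm.trans h2)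
  rw [_root_.inv_zpow, _root_.inv_zpow, _root_.inv_inj] at h3
  rw [Int.modEq_comm, Int.modEq_iff_dvd, ← omega_zpow_eq_one_iff hd, zpow_sub₀ (omega_ne_zero d),
    h3, div_self (zpow_ne_zero _ (omega_ne_zero d))]

theorem eq_smul_one_of_commute_Smat_Tmat {d : ℕ} (hd : d ≠ 0) {M : Matrix (Fin d) (Fin d) ℂ}
    (hS : M * Smat d = Smat d * M) (hT : M * Tmat d = Tmat d * M) :
    ∃ c : ℂ, M = c • (1 : Matrix (Fin d) (Fin d) ℂ) := by
  have hoff : ∀ r s : Fin d, r ≠ s → M r s = 0 := by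
    intro r s hrs
    have h := congrFun (congrFun hT r) s
    simp only [Tmat, Matrix.diagonal_mul, Matrix.mul_diagonal] at h
    have hne : omega d ^ (s : ℕ) ≠ omega d ^ (r : ℕ) := fun h' =>
      hrs (Fin.ext ((omega_isPrimitiveRoot hd).pow_inj s.2 r.2 h').symm)
    have : M r s * (omega d ^ (s : ℕ) - omega d ^ (r : ℕ)) = 0 := by linear_combination h
    exact (mul_eq_zero.1 this).resolve_right (sub_ne_zero.2 hne)
  have hstep : ∀ (n : ℕ) (h : n + 1 < d), M ⟨n + 1, h⟩ ⟨n + 1, h⟩ =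
      M ⟨n, by lia⟩ ⟨n, by lia⟩ := by
    intro n hn
    have h := congrFun (congrFun hS ⟨n + 1, hn⟩) ⟨n, by lia⟩
    rw [Matrix.mul_apply, Matrix.mul_apply, Finset.sum_eq_single ⟨n + 1, hn⟩,
      Finset.sum_eq_single ⟨n, by lia⟩] at h
    · simpa [Smat, Nat.mod_eq_of_lt hn] using h
    · intro k _ hk
      rw [hoff _ _ hk, mul_zero]
    · simp
    · intro k _ hk
      rw [hoff _ _ hk.symm, zero_mul]
    · simp
  have hconst : ∀ (n : ℕ) (h : n < d), M ⟨n, h⟩ ⟨n, h⟩ =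
      M ⟨0, Nat.pos_of_ne_zero hd⟩ ⟨0, Nat.pos_of_ne_zero hd⟩ := by
    intro n
    induction n with
    | zero => intro _; rfl
    | succ n ih => intro h; rw [hstep, ih]
  refine ⟨M ⟨0, Nat.pos_of_ne_zero hd⟩ ⟨0, Nat.pos_of_ne_zero hd⟩, ?_⟩
  ext r s
  by_cases h : r = s
  · subst h
    simpa using hconst r r.2
  · simp [hoff r s h, h]

theorem sq_modEq_one_of_modEq_neg_one {d : ℕ} {t : ℤ} (ht : t ≡ -1 [ZMOD d]) :
    t ^ 2 ≡ 1 [ZMOD dbar d] := by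
  obtain ⟨k, hk⟩ := ht.symm.dvd
  rw [Int.modEq_comm, Int.modEq_iff_dvd]
  obtain rfl : t = -1 + d * k := by lia
  unfold dbar
  split_ifs with ho
  · exact ⟨-2 * k + d * k ^ 2, by ring⟩
  · obtain ⟨m, rfl⟩ := (Nat.even_iff.2 (by lia : d % 2 = 0)).two_dvd
    exact ⟨-k + m * k ^ 2, by push_cast; ring⟩

theorem dvd_dbar (d : ℕ) : (d : ℤ) ∣ dbar d := by
  unfold dbar
  split_ifs
  · exact dvd_rfl
  · exact ⟨2, by push_cast; ring⟩

theorem dvd_symp_add_add {d : ℕ} {F : Matrix (Fin 2) (Fin 2) ℤ} (hdet : F.det ≡ 1 [ZMOD d])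
    (htr : F.trace ≡ -1 [ZMOD d]) (χ p : ℤ × ℤ) :
    (d : ℤ) ∣ symp χ (Fapp F p) + symp χ (Fapp F (Fapp F p)) +
      symp χ (Fapp F (Fapp F (Fapp F p))) := by
  have h : symp χ (Fapp F p) + symp χ (Fapp F (Fapp F p)) +
      symp χ (Fapp F (Fapp F (Fapp F p))) =
      (F.trace - -1) * symp χ (Fapp F (Fapp F p)) - (F.det - 1) * symp χ (Fapp F p) := by
    simp only [symp, Fapp, Matrix.trace_fin_two, Matrix.det_fin_two]
    ring
  rw [h]
  exact dvd_sub (dvd_mul_of_dvd_left htr.symm.dvd _) (dvd_mul_of_dvd_left hdet.symm.dvd _)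

theorem Fapp_Fapp_Fapp (F : Matrix (Fin 2) (Fin 2) ℤ) (p : ℤ × ℤ) :
    Fapp F (Fapp F (Fapp F p)) =
      (F.trace ^ 2 - F.det) • Fapp F p - (F.trace * F.det) • p := by
  ext <;> simp only [Fapp, Matrix.trace_fin_two, Matrix.det_fin_two, Prod.fst_sub, Prod.snd_sub,
    Prod.smul_fst, Prod.smul_snd, smul_eq_mul] <;> ring

theorem Dmat_Fapp_Fapp_Fapp {d : ℕ} (hd : d ≠ 0) {F : Matrix (Fin 2) (Fin 2) ℤ}
    (hdet : F.det ≡ 1 [ZMOD dbar d]) (htr : F.trace ≡ -1 [ZMOD d]) (p : ℤ × ℤ) :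
    Dmat d (Fapp F (Fapp F (Fapp F p))) = Dmat d p := by
  have h2 := sq_modEq_one_of_modEq_neg_one htr
  have h0 : F.trace ^ 2 - F.det ≡ 0 [ZMOD dbar d] := by simpa using h2.sub hdet
  have h0' : F.trace ^ 2 - F.det ≡ 0 [ZMOD d] := h0.of_dvd (dvd_dbar d)
  have h1 : F.trace * F.det ≡ -1 [ZMOD d] := by
    simpa using htr.mul (hdet.of_dvd (dvd_dbar d))
  have h1' : (F.trace * F.det) ^ 2 ≡ 1 [ZMOD dbar d] := by
    simpa [mul_pow] using h2.mul (hdet.pow 2)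
  rw [Fapp_Fapp_Fapp]
  generalize Fapp F p = q
  apply Dmat_congr hd
  · simpa using (h0'.mul_right q.1).sub (h1.mul_right p.1)
  · simpa using (h0'.mul_right q.2).sub (h1.mul_right p.2)
  · have h := (h0.mul_right (q.1 * ((F.trace ^ 2 - F.det) * q.2 - F.trace * F.det * p.2)
      - q.2 * (F.trace * F.det * p.1))).add (h1'.mul_right (p.1 * p.2))
    simp only [zero_mul, zero_add, one_mul] at h
    convert h using 1
    simp only [Prod.fst_sub, Prod.snd_sub, Prod.smul_fst, Prod.smul_snd, smul_eq_mul]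
    ring

/-- Let `d ≥ 2`, `d ≠ 3`, and let the unitary `U` implement the
Clifford operation `[F,χ]` where `det F ≡ 1 (mod d̄)` and `trace F ≡ −1 (mod d)`.
Then `U³` is a scalar multiple of the identity, while neither `U` nor `U²` is: the
Clifford operation determined by `U` has order exactly 3. -/
theorem stmt12 (d : ℕ) (hd : 2 ≤ d) (hd3 : d ≠ 3)
    (U : Matrix (Fin d) (Fin d) ℂ) (hU : U ∈ Matrix.unitaryGroup (Fin d) ℂ)
    (F : Matrix (Fin 2) (Fin 2) ℤ) (χ : ℤ × ℤ)
    (hdet : F.det ≡ 1 [ZMOD (dbar d)]) (htr : F.trace ≡ -1 [ZMOD (d : ℕ)])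
    (hconj : ∀ p : ℤ × ℤ,
      U * Dmat d p * Uᴴ = omega d ^ symp χ (Fapp F p) • Dmat d (Fapp F p)) :
    (∃ c : ℂ, U ^ 3 = c • (1 : Matrix (Fin d) (Fin d) ℂ)) ∧
      ¬ (∃ c : ℂ, U = c • (1 : Matrix (Fin d) (Fin d) ℂ)) ∧
      ¬ (∃ c : ℂ, U ^ 2 = c • (1 : Matrix (Fin d) (Fin d) ℂ)) := by
  have hd0 : d ≠ 0 := by lia
  have : NeZero d := ⟨hd0⟩
  have hUU : Uᴴ * U = 1 := Matrix.mem_unitaryGroup_iff'.1 hU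
  have hstep : ∀ p, U * Dmat d p = omega d ^ symp χ (Fapp F p) • (Dmat d (Fapp F p) * U) := by
    intro p
    rw [← Matrix.smul_mul, ← hconj, mul_assoc, hUU, mul_one]
  have hcomm : ∀ p, U ^ 3 * Dmat d p = Dmat d p * U ^ 3 := by
    intro p
    have hphase : omega d ^ symp χ (Fapp F p) * omega d ^ symp χ (Fapp F (Fapp F p)) *
        omega d ^ symp χ (Fapp F (Fapp F (Fapp F p))) = 1 := by
      rw [← zpow_add₀ (omega_ne_zero d), ← zpow_add₀ (omega_ne_zero d), omega_zpow_eq_one_iff hd0]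
      exact dvd_symp_add_add (hdet.of_dvd (dvd_dbar d)) htr χ p
    calc U ^ 3 * Dmat d p = U * (U * (U * Dmat d p)) := by simp only [pow_succ, pow_zero, one_mul,
          mul_assoc]
      _ = (omega d ^ symp χ (Fapp F p) * omega d ^ symp χ (Fapp F (Fapp F p)) *
        omega d ^ symp χ (Fapp F (Fapp F (Fapp F p)))) •
          (Dmat d (Fapp F (Fapp F (Fapp F p))) * U * U * U) := by
        rw [hstep, Matrix.mul_smul, ← mul_assoc U, hstep, Matrix.smul_mul, Matrix.mul_smul,
          Matrix.mul_smul, ← mul_assoc U, ← mul_assoc U, hstep, Matrix.smul_mul, Matrix.smul_mul,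
          smul_smul, smul_smul]
      _ = Dmat d p * U ^ 3 := by
        rw [hphase, one_smul, Dmat_Fapp_Fapp_Fapp hd0 hdet htr]
        simp only [pow_succ, pow_zero, one_mul, mul_assoc]
  have hcube : ∃ c : ℂ, U ^ 3 = c • (1 : Matrix (Fin d) (Fin d) ℂ) := by
    refine eq_smul_one_of_commute_Smat_Tmat hd0 ?_ ?_
    · simpa only [Dmat_one_zero] using hcomm (1, 0)
    · simpa only [Dmat_zero_one] using hcomm (0, 1)
  have hone : ¬ ∃ c : ℂ, U = c • (1 : Matrix (Fin d) (Fin d) ℂ) := by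
    rintro ⟨c, hc⟩
    have hD : ∀ p, Dmat d p = omega d ^ symp χ (Fapp F p) • Dmat d (Fapp F p) := by
      intro p
      have hcp : U * Dmat d p = Dmat d p * U := by
        rw [hc, Matrix.smul_mul, Matrix.mul_smul, one_mul, mul_one]
      have hUU' : U * Uᴴ = 1 := Matrix.mem_unitaryGroup_iff.1 hU
      rw [← hconj, hcp, mul_assoc, hUU', mul_one]
    have h1 : (1 : ℤ) ≡ F 0 0 [ZMOD d] := by
      simpa [Fapp] using fst_modEq_of_Dmat_eq_smul hd0 (hD (1, 0))
    have h2 : (1 : ℤ) ≡ F 1 1 [ZMOD d] := by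
      simpa [Fapp] using snd_modEq_of_Dmat_eq_smul hd0 (hD (0, 1))
    rw [Matrix.trace_fin_two] at htr
    have h3 : (d : ℤ) ∣ (3 : ℕ) := by simpa using ((h1.add h2).trans htr).symm.dvd
    rcases (Nat.dvd_prime Nat.prime_three).1 (Int.natCast_dvd_natCast.1 h3) with h | h <;> lia
  refine ⟨hcube, hone, ?_⟩
  rintro ⟨b, hb⟩
  obtain ⟨c, hc⟩ := hcube
  have hb0 : b ≠ 0 := by
    rintro rfl
    have hunit : IsUnit (U ^ 2) := (IsUnit.of_mul_eq_one_right _ hUU).pow 2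
    rw [hb, zero_smul] at hunit
    exact not_isUnit_zero hunit
  refine hone ⟨b⁻¹ * c, ?_⟩
  rw [mul_smul, ← hc, eq_inv_smul_iff₀ hb0, pow_succ, hb, Matrix.smul_mul, one_mul]
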